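/- arXiv:2401.07578 — 3 statements merged into one kernel-verified Lean document; each statement's English description precedes it below -/
import Mathlib

section
/- Perturbation stability of n(·): let q, q̂ : I → ℝ be nonnegative vectors such that q has at least one strictly positive entry. Let K := max_{i ∈ I} k i and q* := min{ q i | i ∈ I, q i > 0 }. If |q̂ i − q i| ≤ (1/4)·(1 − 2^{−1/K})·q* for every i ∈ I, then n(q̂) ≤ 2·n(q). -/
open Finset

/-- The feasible set `S(q) = {τ > 0 | ∑_i c_i · 1[q_i < (1/τ)^{1/k_i}] ≤ τ}`. -/
noncomputable def feasibleSet {I : Type*} [Fintype I] (c : I → ℝ) (k : I → ℕ)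
    (q : I → ℝ) : Set ℝ :=
  {τ : ℝ | 0 < τ ∧ ∑ i, (if q i < (1 / τ) ^ ((1 : ℝ) / (k i)) then c i else 0) ≤ τ}

/-- The threshold `n(q) = inf S(q)`. -/
noncomputable def nVal {I : Type*} [Fintype I] (c : I → ℝ) (k : I → ℕ) (q : I → ℝ) : ℝ :=
  sInf (feasibleSet c k q)

theorem feasibleSet_nonempty {I : Type*} [Fintype I] [Nonempty I]
    (c : I → ℝ) (hc : ∀ i, 1 ≤ c i) (k : I → ℕ) (q : I → ℝ) :
    (feasibleSet c k q).Nonempty := by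
  refine ⟨∑ i, c i, Finset.sum_pos (fun i _ => by linarith [hc i]) Finset.univ_nonempty,
    Finset.sum_le_sum fun i _ => ?_⟩
  split_ifs
  · exact le_rfl
  · linarith [hc i]

theorem bddBelow_feasibleSet {I : Type*} [Fintype I] (c : I → ℝ) (k : I → ℕ) (q : I → ℝ) :
    BddBelow (feasibleSet c k q) :=
  ⟨0, fun _ hτ => hτ.1.le⟩

/-- If every positive entry shrinks by a factor of at most `2 ^ (-1 / k i)` from `q` to `q'`,
then doubling maps `feasibleSet c k q` into `feasibleSet c k q'`. -/
theorem two_mul_mem_feasibleSet {I : Type*} [Fintype I] {c : I → ℝ} (hc : ∀ i, 0 ≤ c i)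
    {k : I → ℕ} {q q' : I → ℝ}
    (h : ∀ i, 0 < q i → (2 : ℝ) ^ (-(1 : ℝ) / k i) * q i ≤ q' i)
    {τ : ℝ} (hτ : τ ∈ feasibleSet c k q) :
    2 * τ ∈ feasibleSet c k q' := by
  obtain ⟨hτ0, hτ⟩ := hτ
  refine ⟨by positivity, le_trans (Finset.sum_le_sum fun i _ => ?_) (hτ.trans (by linarith))⟩
  by_cases hi : q i < (1 / τ) ^ ((1 : ℝ) / k i)
  · rw [if_pos hi]
    split_ifs
    · exact le_rfl
    · exact hc i
  · have hpos : 0 < q i := lt_of_lt_of_le (by positivity) (not_lt.mp hi)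
    have hsplit : (1 / (2 * τ)) ^ ((1 : ℝ) / k i)
        = (2 : ℝ) ^ (-(1 : ℝ) / k i) * (1 / τ) ^ ((1 : ℝ) / k i) := by
      have hτi : 0 ≤ 1 / τ := by positivity
      rw [← one_div_mul_one_div, Real.mul_rpow (by norm_num) hτi, neg_div,
        Real.rpow_neg (by norm_num), one_div 2, Real.inv_rpow (by norm_num)]
    have hle : (1 / (2 * τ)) ^ ((1 : ℝ) / k i) ≤ q' i := by
      rw [hsplit]
      exact (mul_le_mul_of_nonneg_left (not_lt.mp hi) (by positivity)).trans (h i hpos)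
    rw [if_neg hi, if_neg hle.not_gt]

/-- Perturbation stability of `n(·)`: if `q̂` is entrywise within
`(1/4)(1 − 2^{−1/K}) q*` of `q`, where `K = max_i k_i` and `q*` is the least strictly
positive entry of `q`, then `n(q̂) ≤ 2 n(q)`. -/
theorem stmt_2 {I : Type*} [Fintype I] [Nonempty I]
    (c : I → ℝ) (hc : ∀ i, 1 ≤ c i) (k : I → ℕ) (hk : ∀ i, 1 ≤ k i)
    (q qhat : I → ℝ) (hq : ∀ i, 0 ≤ q i) (hqhat : ∀ i, 0 ≤ qhat i)
    (hpos : ∃ i, 0 < q i)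
    (K : ℕ) (hK : K = Finset.univ.sup k)
    (qstar : ℝ) (hqs : IsLeast {x : ℝ | ∃ i, 0 < q i ∧ q i = x} qstar)
    (hclose : ∀ i, |qhat i - q i| ≤ (1 / 4) * (1 - (2 : ℝ) ^ (-(1 : ℝ) / K)) * qstar) :
    nVal c k qhat ≤ 2 * nVal c k q := by
  have hmem : ∀ τ ∈ feasibleSet c k q, 2 * τ ∈ feasibleSet c k qhat := by
    intro τ hτ
    refine two_mul_mem_feasibleSet (fun i => by linarith [hc i]) (fun i hi => ?_) hτ
    have hqi : qstar ≤ q i := hqs.2 ⟨i, hi, rfl⟩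
    have hki : (0 : ℝ) < k i := by exact_mod_cast hk i
    have hkK : (k i : ℝ) ≤ K := by
      rw [hK]
      exact_mod_cast Finset.le_sup (f := k) (Finset.mem_univ i)
    have hpow : (2 : ℝ) ^ (-(1 : ℝ) / k i) ≤ (2 : ℝ) ^ (-(1 : ℝ) / K) := by
      apply Real.rpow_le_rpow_of_exponent_le (by norm_num)
      rw [neg_div, neg_div]
      exact neg_le_neg (one_div_le_one_div_of_le hki hkK)
    have hone : (2 : ℝ) ^ (-(1 : ℝ) / K) ≤ 1 := by
      apply Real.rpow_le_one_of_one_le_of_nonpos (by norm_num)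
      rw [neg_div]
      exact neg_nonpos.mpr (by positivity)
    have hdist := (abs_le.mp (hclose i)).1
    have hgap := mul_le_mul_of_nonneg_left hqi (sub_nonneg.mpr hone)
    have hgap0 := mul_nonneg (sub_nonneg.mpr hone) hi.le
    have hscale := mul_le_mul_of_nonneg_right hpow hi.le
    linarith
  have hle : nVal c k qhat / 2 ≤ nVal c k q :=
    le_csInf (feasibleSet_nonempty c hc k q) fun τ hτ => by
      have : nVal c k qhat ≤ 2 * τ := csInf_le (bddBelow_feasibleSet c k qhat) (hmem τ hτ)
      linarith
  linarith
end

section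
/- Comparison of n(·) with the uniform-cost threshold m'(·): suppose k i = 1 for every i ∈ I and c i = c for every i ∈ I, where c ≥ 1 is a constant. For a nonnegative vector q : I → ℝ define m'(q) := sInf { τ : ℝ | 0 < τ ∧ ∑_{i ∈ I} (if q i < 1/τ then 1 else 0) ≤ τ }. Then n(q) ≤ c · m'(q). -/
open Finset

/-- The uniform-cost threshold `m'(q) = inf {τ > 0 | ∑_i 1[q_i < 1/τ] ≤ τ}`. -/
noncomputable def mVal {I : Type*} [Fintype I] (q : I → ℝ) : ℝ :=
  sInf {τ : ℝ | 0 < τ ∧ ∑ i : I, (if q i < 1 / τ then (1 : ℝ) else 0) ≤ τ}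

theorem mul_mem_feasibleSet {I : Type*} [Fintype I] {cost : I → ℝ} {c : ℝ} (hc : 1 ≤ c)
    (hcost : ∀ i, cost i = c) {k : I → ℕ} (hk : ∀ i, k i = 1) {q : I → ℝ} {τ : ℝ} (hτ : 0 < τ)
    (h : ∑ i : I, (if q i < 1 / τ then (1 : ℝ) else 0) ≤ τ) :
    c * τ ∈ feasibleSet cost k q := by
  have hc0 : 0 < c := by linarith
  refine ⟨by positivity, le_trans ?_ (mul_le_mul_of_nonneg_left h hc0.le)⟩
  rw [Finset.mul_sum]
  refine Finset.sum_le_sum fun i _ => ?_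
  have hle : 1 / (c * τ) ≤ 1 / τ :=
    one_div_le_one_div_of_le hτ (le_mul_of_one_le_left hτ.le hc)
  simp only [hcost, hk, Nat.cast_one, div_one, Real.rpow_one]
  split_ifs <;> linarith

/-- Comparison with the uniform-cost threshold: when all exponents are `1` and all
costs equal a constant `c ≥ 1`, one has `n(q) ≤ c · m'(q)`. -/
theorem stmt_4 {I : Type*} [Fintype I] [Nonempty I]
    (cost : I → ℝ) (c : ℝ) (hc : 1 ≤ c) (hcost : ∀ i, cost i = c)
    (k : I → ℕ) (hk : ∀ i, k i = 1)
    (q : I → ℝ) (hq : ∀ i, 0 ≤ q i) :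
    nVal cost k q ≤ c * mVal q := by
  have hc0 : 0 < c := by linarith
  rw [← div_le_iff₀' hc0]
  refine le_csInf ⟨Fintype.card I, by exact_mod_cast Fintype.card_pos, ?_⟩ ?_
  · refine (Finset.sum_le_card_nsmul _ _ 1 fun i _ => ?_).trans (by simp)
    split_ifs <;> norm_num
  · rintro τ ⟨hτ, h⟩
    rw [div_le_iff₀' hc0]
    exact csInf_le ⟨0, fun x hx => hx.1.le⟩ (mul_mem_feasibleSet hc hcost hk hτ h)
end

section
/- Let N be an integrable random variable on a probability space taking values in the natural numbers, and let X be a random variable with 0 ≤ X ≤ 1 almost surely. Let p > 0 and α ∈ [0,1] be reals such that for every natural number n, P(X ≤ p/2 and N = n) ≤ α·P(N = n). Then E[X·N] ≥ (p/2)·(1 − α)·E[N]. -/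
open MeasureTheory

/-- On a countable space with measurable singletons, an inequality of measures can be checked on
singletons. -/
theorem MeasureTheory.Measure.le_of_forall_singleton_le {β : Type*} [MeasurableSpace β]
    [Countable β] [MeasurableSingletonClass β] {μ ν : Measure β} (h : ∀ b, μ {b} ≤ ν {b}) :
    μ ≤ ν := by
  refine Measure.le_iff.2 fun s hs => ?_
  rw [← μ.tsum_indicator_apply_singleton s hs, ← ν.tsum_indicator_apply_singleton s hs]
  exact ENNReal.tsum_le_tsum fun b => Set.indicator_le_indicator (h b)

/-- If `N` is an integrable ℕ-valued random variable, `X ∈ [0,1]` a.s., and for every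
`n` the event `{X ≤ p/2, N = n}` has probability at most `α · P(N = n)`, then
`E[X·N] ≥ (p/2)(1 − α) E[N]`. -/
theorem stmt_10 {Ω : Type*} [MeasurableSpace Ω] (μ : Measure Ω) [IsProbabilityMeasure μ]
    (N : Ω → ℕ) (hNmeas : Measurable N)
    (hNint : Integrable (fun ω => (N ω : ℝ)) μ)
    (X : Ω → ℝ) (hXmeas : Measurable X)
    (hX : ∀ᵐ ω ∂μ, X ω ∈ Set.Icc (0 : ℝ) 1)
    (p α : ℝ) (hp : 0 < p) (hα : α ∈ Set.Icc (0 : ℝ) 1)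
    (h : ∀ n : ℕ, μ {ω | X ω ≤ p / 2 ∧ N ω = n} ≤ ENNReal.ofReal α * μ {ω | N ω = n}) :
    (p / 2) * (1 - α) * ∫ ω, (N ω : ℝ) ∂μ ≤ ∫ ω, X ω * (N ω : ℝ) ∂μ := by
  have hA : MeasurableSet {ω | X ω ≤ p / 2} := measurableSet_le hXmeas measurable_const
  have hmap : (μ.restrict {ω | X ω ≤ p / 2}).map N ≤ ENNReal.ofReal α • μ.map N := by
    refine Measure.le_of_forall_singleton_le fun n => ?_
    have hn : MeasurableSet (N ⁻¹' {n}) := hNmeas (measurableSet_singleton n)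
    rw [Measure.map_apply hNmeas (measurableSet_singleton n), Measure.restrict_apply hn,
      Measure.smul_apply, Measure.map_apply hNmeas (measurableSet_singleton n), smul_eq_mul,
      Set.inter_comm]
    exact h n
  have hcast {ν : Measure ℕ} : AEStronglyMeasurable (fun n : ℕ => (n : ℝ)) ν :=
    (measurable_of_countable _).aestronglyMeasurable
  have hint : Integrable (fun n : ℕ => (n : ℝ)) (ENNReal.ofReal α • μ.map N) :=
    ((integrable_map_measure hcast hNmeas.aemeasurable).2 hNint).smul_measure
      ENNReal.ofReal_ne_top
  have hset : ∫ ω in {ω | X ω ≤ p / 2}, (N ω : ℝ) ∂μ ≤ α * ∫ ω, (N ω : ℝ) ∂μ := by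
    have := integral_mono_measure hmap (ae_of_all _ fun n : ℕ => n.cast_nonneg (α := ℝ)) hint
    rwa [integral_smul_measure, integral_map hNmeas.aemeasurable hcast,
      integral_map hNmeas.aemeasurable hcast, ENNReal.toReal_ofReal hα.1, smul_eq_mul] at this
  have hXN : Integrable (fun ω => X ω * (N ω : ℝ)) μ := by
    refine hNint.bdd_mul (c := 1) hXmeas.aestronglyMeasurable ?_
    filter_upwards [hX] with ω hω
    rw [Real.norm_of_nonneg hω.1]
    exact hω.2
  have hind : Integrable ({ω | X ω ≤ p / 2}.indicator fun ω => (N ω : ℝ)) μ := hNint.indicator hA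
  calc (p / 2) * (1 - α) * ∫ ω, (N ω : ℝ) ∂μ
      = (p / 2) * (∫ ω, (N ω : ℝ) ∂μ - α * ∫ ω, (N ω : ℝ) ∂μ) := by ring
    _ ≤ (p / 2) * (∫ ω, (N ω : ℝ) ∂μ - ∫ ω in {ω | X ω ≤ p / 2}, (N ω : ℝ) ∂μ) := by gcongr
    _ = ∫ ω, (p / 2) * ((N ω : ℝ) - {ω | X ω ≤ p / 2}.indicator (fun ω => (N ω : ℝ)) ω) ∂μ := by
      rw [integral_const_mul, integral_sub hNint hind, integral_indicator hA]
    _ ≤ ∫ ω, X ω * (N ω : ℝ) ∂μ := by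
      refine integral_mono_ae ((hNint.sub hind).const_mul _) hXN ?_
      filter_upwards [hX] with ω hω
      by_cases hω' : X ω ≤ p / 2
      · simpa [Set.indicator, hω'] using mul_nonneg hω.1 (N ω).cast_nonneg
      · simpa [Set.indicator, hω'] using
          mul_le_mul_of_nonneg_right (not_le.1 hω').le (N ω).cast_nonneg
end
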